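/- arXiv:2010.07745 — 7 statements merged into one kernel-verified Lean document; each statement's English description precedes it below -/
import Mathlib

section
/- Let s₁, s₂ ≥ 1, let n = s₁ + s₂, and let the vertex set of the complete graph K_n be partitioned into sets A and B with |A| = s₁ and |B| = s₂. Let d be an integer with 1 ≤ d ≤ s₁ + s₂ − 1, and let c be the configuration with c(v) = 0 for v ∈ A and c(v) = d for v ∈ B. Then F(c)(v) = s₂ for every v ∈ A and F(c)(v) = d − s₁ for every v ∈ B; in particular F(c)(a) > F(c)(b) for all a ∈ A, b ∈ B, and F(F(c)) = c. -/
/-- The parallel diffusion firing operator on the complete graph on a finite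
vertex type `V`: `F(c)(v) = c(v) + #{u ≠ v : c(u) > c(v)} - #{u ≠ v : c(u) < c(v)}`. -/
def fireK {V : Type*} [Fintype V] [DecidableEq V] (c : V → ℤ) : V → ℤ :=
  fun v =>
    c v + ((Finset.univ.filter fun u => u ≠ v ∧ c v < c u).card : ℤ)
        - ((Finset.univ.filter fun u => u ≠ v ∧ c u < c v).card : ℤ)

/-- Firing a two-valued configuration with value `x` on `X` and a larger value `y` on the
complement `Y`: every vertex of `X` gains `#Y` and every vertex of `Y` loses `#X`. -/
theorem fireK_of_two_values {V : Type*} [Fintype V] [DecidableEq V] {X Y : Finset V}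
    (hdisj : Disjoint X Y) (hcover : X ∪ Y = Finset.univ) {x y : ℤ} (hxy : x < y)
    {c : V → ℤ} (hX : ∀ v ∈ X, c v = x) (hY : ∀ v ∈ Y, c v = y) :
    (∀ v ∈ X, fireK c v = x + Y.card) ∧ (∀ v ∈ Y, fireK c v = y - X.card) := by
  have hmem (u : V) : u ∈ X ∨ u ∈ Y := by
    simp [← Finset.mem_union, hcover]
  have hnot (u : V) (h : u ∈ X) : u ∉ Y := Finset.disjoint_left.mp hdisj h
  constructor
  · intro v hv
    have hgt : (Finset.univ.filter fun u => u ≠ v ∧ c v < c u) = Y := by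
      ext u
      simp only [Finset.mem_filter, Finset.mem_univ, true_and]
      grind
    have hlt : (Finset.univ.filter fun u => u ≠ v ∧ c u < c v) = ∅ := by
      ext u
      simp only [Finset.mem_filter, Finset.mem_univ, true_and]
      grind
    rw [fireK, hgt, hlt, hX v hv, Finset.card_empty, Nat.cast_zero, sub_zero]
  · intro v hv
    have hgt : (Finset.univ.filter fun u => u ≠ v ∧ c v < c u) = ∅ := by
      ext u
      simp only [Finset.mem_filter, Finset.mem_univ, true_and]
      grind
    have hlt : (Finset.univ.filter fun u => u ≠ v ∧ c u < c v) = X := by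
      ext u
      simp only [Finset.mem_filter, Finset.mem_univ, true_and]
      grind
    rw [fireK, hgt, hlt, hY v hv, Finset.card_empty, Nat.cast_zero, add_zero]

/-- On `K_n` with `n = s₁ + s₂`, vertex set partitioned into `A` (size `s₁`,
stack size `0`) and `B` (size `s₂`, stack size `d`) with `1 ≤ d ≤ s₁ + s₂ - 1`:
after firing, each vertex of `A` has `s₂` chips, each vertex of `B` has
`d - s₁` chips, every vertex of `A` is now richer than every vertex of `B`,
and firing twice returns the original configuration. -/
theorem two_strip_period (s₁ s₂ : ℕ) (hs₁ : 1 ≤ s₁) (hs₂ : 1 ≤ s₂)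
    (A B : Finset (Fin (s₁ + s₂)))
    (hA : A.card = s₁) (hB : B.card = s₂)
    (hdisj : Disjoint A B) (hcover : A ∪ B = Finset.univ)
    (d : ℤ) (hd1 : 1 ≤ d) (hd2 : d ≤ (s₁ : ℤ) + (s₂ : ℤ) - 1)
    (c : Fin (s₁ + s₂) → ℤ)
    (hcA : ∀ v ∈ A, c v = 0) (hcB : ∀ v ∈ B, c v = d) :
    (∀ v ∈ A, fireK c v = (s₂ : ℤ)) ∧
    (∀ v ∈ B, fireK c v = d - (s₁ : ℤ)) ∧
    (∀ a ∈ A, ∀ b ∈ B, fireK c a > fireK c b) ∧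
    fireK (fireK c) = c := by
  obtain ⟨hA₁, hB₁⟩ := fireK_of_two_values hdisj hcover (by lia) hcA hcB
  simp only [hA, hB, zero_add] at hA₁ hB₁
  obtain ⟨hB₂, hA₂⟩ := fireK_of_two_values hdisj.symm (by rwa [Finset.union_comm])
    (by lia) hB₁ hA₁
  refine ⟨hA₁, hB₁, fun a ha b hb => ?_, funext fun v => ?_⟩
  · rw [hA₁ a ha, hB₁ b hb]
    lia
  · rcases Finset.mem_union.mp (hcover ▸ Finset.mem_univ v) with hv | hv
    · rw [hA₂ v hv, hcA v hv, hB, sub_self]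
    · rw [hB₂ v hv, hcB v hv, hA, sub_add_cancel]
end

section
/- Let c be a configuration on the complete graph K_n whose set of distinct values is a₁ < a₂ < … < a_N, where the value a_j is taken by exactly s_j ≥ 1 vertices (so s₁ + ⋯ + s_N = n). If a_j − a_{j−1} ≤ s_{j−1} + s_j − 1 for every j with 2 ≤ j ≤ N, then F(F(c)) = c; in particular c is a period configuration of K_n. -/
theorem fireK_apply {V : Type*} [Fintype V] [DecidableEq V] (c : V → ℤ) (v : V) :
    fireK c v = c v + ((Finset.univ.filter fun u => c v < c u).card : ℤ)
      - ((Finset.univ.filter fun u => c u < c v).card : ℤ) := by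
  have h₁ : ∀ u, (u ≠ v ∧ c v < c u) ↔ c v < c u := fun u =>
    ⟨And.right, fun h => ⟨by rintro rfl; exact lt_irrefl _ h, h⟩⟩
  have h₂ : ∀ u, (u ≠ v ∧ c u < c v) ↔ c u < c v := fun u =>
    ⟨And.right, fun h => ⟨by rintro rfl; exact lt_irrefl _ h, h⟩⟩
  simp only [fireK, h₁, h₂]

/-- If one firing reverses the order of the values, a second firing undoes it. -/
theorem fireK_fireK_of_reverses {V : Type*} [Fintype V] [DecidableEq V] (c : V → ℤ)
    (h : ∀ u v, fireK c u < fireK c v ↔ c v < c u) : fireK (fireK c) = c := by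
  funext v
  rw [fireK_apply (fireK c) v]
  simp only [h]
  rw [fireK_apply c v]
  ring

/-- If no vertex has a value strictly between `x < y`, and the vertices with value `x` or `y`
number more than `y - x`, then firing reverses the order of `x` and `y`. -/
theorem fire_value_lt_of_gap {V : Type*} [Fintype V] (c : V → ℤ) {x y : ℤ}
    (hxy : x < y) (hbetween : ∀ v, c v ≤ x ∨ y ≤ c v)
    (hgap : y - x < ((Finset.univ.filter fun v => c v = x).card : ℤ)
      + ((Finset.univ.filter fun v => c v = y).card : ℤ)) :
    y + ((Finset.univ.filter fun u => y < c u).card : ℤ)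
        - ((Finset.univ.filter fun u => c u < y).card : ℤ)
      < x + ((Finset.univ.filter fun u => x < c u).card : ℤ)
        - ((Finset.univ.filter fun u => c u < x).card : ℤ) := by
  classical
  have above : (Finset.univ.filter fun u => x < c u).card
      = (Finset.univ.filter fun u => c u = y).card
        + (Finset.univ.filter fun u => y < c u).card := by
    rw [← Finset.card_union_of_disjoint
      (Finset.disjoint_filter.2 fun u _ h => by omega), ← Finset.filter_or]
    congr 1
    ext u
    have := hbetween u
    simp only [Finset.mem_filter, Finset.mem_univ, true_and]
    omega
  have below : (Finset.univ.filter fun u => c u < y).card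
      = (Finset.univ.filter fun u => c u = x).card
        + (Finset.univ.filter fun u => c u < x).card := by
    rw [← Finset.card_union_of_disjoint
      (Finset.disjoint_filter.2 fun u _ h => by omega), ← Finset.filter_or]
    congr 1
    ext u
    have := hbetween u
    simp only [Finset.mem_filter, Finset.mem_univ, true_and]
    omega
  omega

/-- If the distinct values of a configuration `c` on `K_n` are
`a 0 < a 1 < … < a (N-1)`, with the value `a j` taken by exactly `s j ≥ 1`
vertices, and every consecutive gap satisfies
`a (j+1) - a j ≤ s j + s (j+1) - 1`, then `F(F(c)) = c`; in particular `c` is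
a period configuration of `K_n`. -/
theorem small_gaps_period {n N : ℕ} (a : Fin N → ℤ) (ha : StrictMono a)
    (s : Fin N → ℕ) (hs : ∀ j, 1 ≤ s j) (hsum : ∑ j, s j = n)
    (c : Fin n → ℤ)
    (hvals : ∀ v, ∃ j, c v = a j)
    (hcount : ∀ j, (Finset.univ.filter fun v => c v = a j).card = s j)
    (hgap : ∀ j k : Fin N, (k : ℕ) = (j : ℕ) + 1 →
      a k - a j ≤ (s j : ℤ) + (s k : ℤ) - 1) :
    fireK (fireK c) = c := by
  have hanti : StrictAnti fun j => a j + ((Finset.univ.filter fun u => a j < c u).card : ℤ)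
      - ((Finset.univ.filter fun u => c u < a j).card : ℤ) := by
    cases N with
    | zero => exact fun j => j.elim0
    | succ m =>
      refine Fin.strictAnti_iff_succ_lt.2 fun i => ?_
      refine fire_value_lt_of_gap c (ha Fin.castSucc_lt_succ) (fun v => ?_) ?_
      · obtain ⟨k, hk⟩ := hvals v
        rw [hk, ha.le_iff_le, ha.le_iff_le, Fin.le_def, Fin.le_def, Fin.val_castSucc,
          Fin.val_succ]
        omega
      · have := hgap i.castSucc i.succ (by simp)
        rw [hcount, hcount]
        omega
  refine fireK_fireK_of_reverses c fun u v => ?_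
  obtain ⟨j, hj⟩ := hvals u
  obtain ⟨k, hk⟩ := hvals v
  rw [fireK_apply, fireK_apply, hj, hk, ha.lt_iff_lt]
  exact hanti.lt_iff_gt
end

section
/- Let V be a finite set, let W be a nonempty proper subset of V, and let c : V → ℤ be a configuration on the complete graph on V such that c is constant on W and c(w) > c(v) for every w ∈ W and v ∈ V∖W. Let c' be the restriction of c to V∖W and let F' denote the firing operator of the complete graph on V∖W. Then F(c)(v) = F'(c')(v) + |W| for every v ∈ V∖W; in particular, for all u, v ∈ V∖W, F(c)(u) > F(c)(v) if and only if F'(c')(u) > F'(c')(v). -/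
/-- The elements outside `W` satisfying `p`, counted in the subtype or in the ambient type. -/
theorem card_filter_subtype_notMem {V : Type*} [Fintype V] [DecidableEq V]
    (W : Finset V) (p : V → Prop) [DecidablePred p] :
    (Finset.univ.filter fun u : {x : V // x ∉ W} => p u.val).card =
      (Finset.univ.filter fun u : V => u ∉ W ∧ p u).card := by
  rw [← Finset.card_map (Function.Embedding.subtype fun x : V => x ∉ W)]
  congr 1
  ext x
  simp [and_comm]

/-- Removing a block `W` of vertices richer than all others lowers the result of firing
at each remaining vertex by `W.card`. -/
theorem fireK_eq_fireK_restrict_add_card {V : Type*} [Fintype V] [DecidableEq V]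
    (W : Finset V) (c : V → ℤ) (hrich : ∀ w ∈ W, ∀ v, v ∉ W → c v < c w)
    (v : V) (h : v ∉ W) :
    fireK c v =
      fireK (fun u : {x : V // x ∉ W} => c u.val) ⟨v, h⟩ + (W.card : ℤ) := by
  have hgt : (Finset.univ.filter fun u => u ≠ v ∧ c v < c u) =
      (Finset.univ.filter fun u => u ∉ W ∧ u ≠ v ∧ c v < c u) ∪ W := by
    ext x
    simp only [Finset.mem_filter, Finset.mem_univ, true_and, Finset.mem_union]
    grind
  have hdisj : Disjoint (Finset.univ.filter fun u => u ∉ W ∧ u ≠ v ∧ c v < c u) W := by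
    simp +contextual [Finset.disjoint_left]
  have hlt : (Finset.univ.filter fun u => u ≠ v ∧ c u < c v) =
      (Finset.univ.filter fun u => u ∉ W ∧ u ≠ v ∧ c u < c v) := by
    ext x
    simp only [Finset.mem_filter, Finset.mem_univ, true_and]
    grind
  simp only [fireK, ne_eq, Subtype.ext_iff]
  rw [card_filter_subtype_notMem W fun u => ¬u = v ∧ c v < c u,
    card_filter_subtype_notMem W fun u => ¬u = v ∧ c u < c v]
  simp only [ne_eq] at hgt hlt hdisj
  rw [hgt, Finset.card_union_of_disjoint hdisj, hlt]
  push_cast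
  ring

/-- If `W` is a nonempty proper subset of `V` on which the configuration `c`
is constant and strictly richer than all of `V \ W`, then firing the complete
graph on `V` agrees on `V \ W` with firing the complete graph on `V \ W`
(applied to the restriction of `c`) up to the additive constant `|W|`; in
particular the relative order of stack sizes on `V \ W` after firing is the
same in both processes. -/
theorem rich_block_removal {V : Type*} [Fintype V] [DecidableEq V]
    (W : Finset V) (hW : W.Nonempty) (hW' : W ≠ Finset.univ)
    (c : V → ℤ)
    (hconst : ∀ w ∈ W, ∀ w' ∈ W, c w = c w')
    (hrich : ∀ w ∈ W, ∀ v, v ∉ W → c v < c w) :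
    (∀ (v : V) (h : v ∉ W),
        fireK c v =
          fireK (fun u : {x : V // x ∉ W} => c u.val) ⟨v, h⟩ + (W.card : ℤ)) ∧
    (∀ (u v : V) (hu : u ∉ W) (hv : v ∉ W),
        fireK c u > fireK c v ↔
          fireK (fun u : {x : V // x ∉ W} => c u.val) ⟨u, hu⟩ >
            fireK (fun u : {x : V // x ∉ W} => c u.val) ⟨v, hv⟩) := by
  have key := fireK_eq_fireK_restrict_add_card W c hrich
  refine ⟨key, fun u v hu hv => ?_⟩
  rw [key u hu, key v hv]
  exact add_lt_add_iff_right _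
end

section
/- For n ≥ 1, define B(n) = Σ over all compositions (s₁, …, s_N) of n into positive parts of the product Π_{j=2}^{N} (s_{j−1} + s_j − 1), with the empty product equal to 1 when N = 1 (B(n) is the number of board-pile n-ominoes). Then B(1) = 1, B(2) = 2, B(3) = 6, B(4) = 19, and B(n) = 5B(n−1) − 7B(n−2) + 4B(n−3) for all n ≥ 5. -/
/-- The weight `∏ (s_{j-1} + s_j - 1)` of a list of strip lengths. -/
def boardPileWeight (l : List ℕ) : ℕ :=
  ((l.zip l.tail).map (fun p => p.1 + p.2 - 1)).prod

theorem boardPileWeight_singleton (a : ℕ) : boardPileWeight [a] = 1 := by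
  simp [boardPileWeight]

theorem boardPileWeight_cons (k : ℕ) {l : List ℕ} (hl : l ≠ []) :
    boardPileWeight ((k + 1) :: l) = (k + l.headI) * boardPileWeight l := by
  cases l with
  | nil => exact absurd rfl hl
  | cons a t =>
    have h : k + 1 + a - 1 = k + a := by omega
    simp [boardPileWeight, h]

/-- Prepend a part `k + 1` to a composition of `n - k`. -/
def Composition.consPart (n : ℕ) (p : Σ k : Fin (n + 1), Composition (n - k)) :
    Composition (n + 1) where
  blocks := (p.1 + 1) :: p.2.blocks
  blocks_pos := by
    intro i hi
    rcases List.mem_cons.mp hi with rfl | hi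
    · exact Nat.succ_pos _
    · exact p.2.blocks_pos hi
  blocks_sum := by
    have := p.1.2
    rw [List.sum_cons, p.2.blocks_sum]
    omega

theorem Composition.consPart_bijective (n : ℕ) :
    Function.Bijective (Composition.consPart n) := by
  constructor
  · rintro ⟨k, c⟩ ⟨k', c'⟩ h
    have hb := congrArg Composition.blocks h
    simp only [Composition.consPart, List.cons.injEq, Nat.add_right_cancel_iff] at hb
    obtain ⟨hk, hc⟩ := hb
    obtain rfl := Fin.ext hk
    obtain rfl := Composition.ext hc
    rfl
  · intro c
    obtain ⟨l, hpos, hsum⟩ := c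
    cases l with
    | nil => simp at hsum
    | cons a t =>
      have ha : 0 < a := hpos (by simp)
      rw [List.sum_cons] at hsum
      refine ⟨⟨⟨a - 1, by omega⟩, ⟨t, fun h => hpos (by simp [h]), ?_⟩⟩, ?_⟩
      · simp only
        omega
      · ext1
        simp only [Composition.consPart]
        rw [Nat.sub_add_cancel ha]

theorem Composition.sum_blocks_succ {M : Type*} [AddCommMonoid M] (n : ℕ) (f : List ℕ → M) :
    ∑ c : Composition (n + 1), f c.blocks =
      ∑ k ∈ Finset.range (n + 1), ∑ c : Composition (n - k), f ((k + 1) :: c.blocks) := by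
  rw [Finset.sum_range fun k => ∑ c : Composition (n - k), f ((k + 1) :: c.blocks),
    ← Fintype.sum_sigma' fun (k : Fin (n + 1)) (c : Composition (n - k)) =>
      f ((k + 1) :: c.blocks)]
  exact ((Composition.consPart_bijective n).sum_comp fun c => f c.blocks).symm

/-- The total weight of the compositions of `n`. -/
def boardPileTotal (n : ℕ) : ℤ :=
  ∑ c : Composition n, (boardPileWeight c.blocks : ℤ)

/-- The total weight of the compositions of `n`, each multiplied by its first part. -/
def boardPileHeadTotal (n : ℕ) : ℤ :=
  ∑ c : Composition n, (c.blocks.headI : ℤ) * boardPileWeight c.blocks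

theorem sum_boardPileWeight_cons (k : ℕ) {m : ℕ} (hm : 0 < m) :
    ∑ c : Composition m, (boardPileWeight ((k + 1) :: c.blocks) : ℤ) =
      k * boardPileTotal m + boardPileHeadTotal m := by
  rw [boardPileTotal, boardPileHeadTotal, Finset.mul_sum, ← Finset.sum_add_distrib]
  refine Finset.sum_congr rfl fun c _ => ?_
  have hc : c.blocks ≠ [] := by
    intro h
    have := c.blocks_sum
    simp [h] at this
    omega
  rw [boardPileWeight_cons k hc]
  push_cast
  ring

theorem sum_headFun_mul_boardPileWeight (g : ℕ → ℤ) (n : ℕ) :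
    ∑ c : Composition (n + 1), g c.blocks.headI * (boardPileWeight c.blocks : ℤ) =
      g (n + 1) + ∑ i ∈ Finset.range n, g (n - i) *
        (((n : ℤ) - 1 - i) * boardPileTotal (i + 1) + boardPileHeadTotal (i + 1)) := by
  rw [Composition.sum_blocks_succ n fun l => g l.headI * (boardPileWeight l : ℤ),
    Finset.sum_range_succ, add_comm]
  congr 1
  · have h : ∀ m, m = 0 → ∑ c : Composition m,
        g ((n + 1) :: c.blocks).headI * (boardPileWeight ((n + 1) :: c.blocks) : ℤ) =
          g (n + 1) := by
      rintro m rfl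
      have hb : ∀ c : Composition 0, c.blocks = [] := fun c => by
        have := c.blocks_length
        have := c.length_le
        exact List.length_eq_zero_iff.mp (by omega)
      simp [hb, boardPileWeight_singleton, composition_card]
    exact h _ (Nat.sub_self n)
  · rw [← Finset.sum_range_reflect]
    refine Finset.sum_congr rfl fun i hi => ?_
    have hi := Finset.mem_range.mp hi
    simp only [List.headI_cons]
    rw [← Finset.mul_sum, sum_boardPileWeight_cons _ (by omega),
      show n - 1 - i + 1 = n - i by omega, show n - (n - 1 - i) = i + 1 by omega,
      show ((n - 1 - i : ℕ) : ℤ) = (n : ℤ) - 1 - i by omega]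

theorem boardPileTotal_succ (n : ℕ) :
    boardPileTotal (n + 1) = 1 + ∑ i ∈ Finset.range n,
      (((n : ℤ) - 1 - i) * boardPileTotal (i + 1) + boardPileHeadTotal (i + 1)) := by
  rw [boardPileTotal]
  simpa using sum_headFun_mul_boardPileWeight (fun _ => 1) n

theorem boardPileHeadTotal_succ (n : ℕ) :
    boardPileHeadTotal (n + 1) = (n + 1) + ∑ i ∈ Finset.range n, ((n : ℤ) - i) *
      (((n : ℤ) - 1 - i) * boardPileTotal (i + 1) + boardPileHeadTotal (i + 1)) := by
  have h := sum_headFun_mul_boardPileWeight (fun k => (k : ℤ)) n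
  rw [← boardPileHeadTotal] at h
  rw [h]
  push_cast
  congr 1
  refine Finset.sum_congr rfl fun i hi => ?_
  rw [Nat.cast_sub (Finset.mem_range.mp hi).le]

theorem boardPileTotal_sub (n : ℕ) :
    boardPileTotal (n + 2) - boardPileTotal (n + 1) =
      ∑ i ∈ Finset.range n, boardPileTotal (i + 1) + boardPileHeadTotal (n + 1) := by
  have h : ∑ i ∈ Finset.range n, (((n + 1 : ℕ) - 1 - i : ℤ) * boardPileTotal (i + 1) +
        boardPileHeadTotal (i + 1)) =
      ∑ i ∈ Finset.range n, (((n : ℤ) - 1 - i) * boardPileTotal (i + 1) +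
        boardPileHeadTotal (i + 1)) + ∑ i ∈ Finset.range n, boardPileTotal (i + 1) := by
    rw [← Finset.sum_add_distrib]
    refine Finset.sum_congr rfl fun i _ => ?_
    push_cast
    ring
  rw [boardPileTotal_succ (n + 1), boardPileTotal_succ n, Finset.sum_range_succ, h]
  push_cast
  ring

theorem boardPileHeadTotal_sub (n : ℕ) :
    boardPileHeadTotal (n + 2) - boardPileHeadTotal (n + 1) =
      1 + ∑ i ∈ Finset.range n,
        (2 * ((n : ℤ) - i) * boardPileTotal (i + 1) + boardPileHeadTotal (i + 1)) +
        boardPileHeadTotal (n + 1) := by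
  have h : ∑ i ∈ Finset.range n, ((n + 1 : ℕ) - i : ℤ) *
        (((n + 1 : ℕ) - 1 - i : ℤ) * boardPileTotal (i + 1) + boardPileHeadTotal (i + 1)) =
      ∑ i ∈ Finset.range n, ((n : ℤ) - i) *
        (((n : ℤ) - 1 - i) * boardPileTotal (i + 1) + boardPileHeadTotal (i + 1)) +
      ∑ i ∈ Finset.range n,
        (2 * ((n : ℤ) - i) * boardPileTotal (i + 1) + boardPileHeadTotal (i + 1)) := by
    rw [← Finset.sum_add_distrib]
    refine Finset.sum_congr rfl fun i _ => ?_
    push_cast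
    ring
  have h₁ := boardPileHeadTotal_succ (n + 1)
  rw [Finset.sum_range_succ, h] at h₁
  have h₀ := boardPileHeadTotal_succ n
  push_cast at h₁
  linear_combination h₁ - h₀

theorem boardPileHeadTotal_sub_sub (n : ℕ) :
    boardPileHeadTotal (n + 3) - 2 * boardPileHeadTotal (n + 2) + boardPileHeadTotal (n + 1) =
      2 * ∑ i ∈ Finset.range (n + 1), boardPileTotal (i + 1) + boardPileHeadTotal (n + 2) := by
  have h : ∑ i ∈ Finset.range n,
        (2 * ((n + 1 : ℕ) - i : ℤ) * boardPileTotal (i + 1) + boardPileHeadTotal (i + 1)) =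
      ∑ i ∈ Finset.range n,
        (2 * ((n : ℤ) - i) * boardPileTotal (i + 1) + boardPileHeadTotal (i + 1)) +
      2 * ∑ i ∈ Finset.range n, boardPileTotal (i + 1) := by
    rw [Finset.mul_sum, ← Finset.sum_add_distrib]
    refine Finset.sum_congr rfl fun i _ => ?_
    push_cast
    ring
  have h₁ := boardPileHeadTotal_sub (n + 1)
  rw [Finset.sum_range_succ, h] at h₁
  have h₀ := boardPileHeadTotal_sub n
  rw [Finset.sum_range_succ]
  push_cast at h₁
  linear_combination h₁ - h₀

theorem boardPileTotal_recurrence (n : ℕ) :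
    boardPileTotal (n + 5) =
      5 * boardPileTotal (n + 4) - 7 * boardPileTotal (n + 3) + 4 * boardPileTotal (n + 2) := by
  have a₀ := boardPileTotal_sub n
  have a₁ := boardPileTotal_sub (n + 1)
  have a₂ := boardPileTotal_sub (n + 2)
  have a₃ := boardPileTotal_sub (n + 3)
  have c₀ := boardPileHeadTotal_sub_sub n
  have c₁ := boardPileHeadTotal_sub_sub (n + 1)
  simp only [Finset.sum_range_succ, Nat.add_assoc, Nat.reduceAdd] at *
  linarith


/-- If `B n` is the sum, over all compositions `(s₁, …, s_N)` of `n` into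
positive parts, of the product `∏_{j=2}^{N} (s_{j-1} + s_j - 1)` (the empty
product being `1` when `N = 1`) — that is, `B n` is the number of board-pile
`n`-ominoes — then `B 1 = 1`, `B 2 = 2`, `B 3 = 6`, `B 4 = 19`, and
`B n = 5 B (n-1) - 7 B (n-2) + 4 B (n-3)` for all `n ≥ 5`. -/
theorem boardPile_count_recurrence (B : ℕ → ℕ)
    (hB : ∀ n : ℕ, 1 ≤ n →
      B n = ∑ cmp : Composition n,
        ((cmp.blocks.zip cmp.blocks.tail).map (fun p => p.1 + p.2 - 1)).prod) :
    B 1 = 1 ∧ B 2 = 2 ∧ B 3 = 6 ∧ B 4 = 19 ∧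
      ∀ n : ℕ, 5 ≤ n →
        (B n : ℤ) = 5 * B (n - 1) - 7 * B (n - 2) + 4 * B (n - 3) := by
  have hT : ∀ n : ℕ, 1 ≤ n → (B n : ℤ) = boardPileTotal n := by
    intro n hn
    rw [hB n hn, boardPileTotal]
    push_cast [boardPileWeight]
    rfl
  have t₁ : boardPileTotal 1 = 1 := by simpa using boardPileTotal_succ 0
  have c₁ : boardPileHeadTotal 1 = 1 := by simpa using boardPileHeadTotal_succ 0
  have t₂ : boardPileTotal 2 = 2 := by
    have := boardPileTotal_sub 0
    simp at this
    linarith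
  have c₂ : boardPileHeadTotal 2 = 3 := by
    have := boardPileHeadTotal_sub 0
    simp at this
    linarith
  have t₃ : boardPileTotal 3 = 6 := by
    have := boardPileTotal_sub 1
    simp at this
    linarith
  have c₃ : boardPileHeadTotal 3 = 10 := by
    have := boardPileHeadTotal_sub_sub 0
    simp at this
    linarith
  have t₄ : boardPileTotal 4 = 19 := by
    have := boardPileTotal_sub 2
    simp [Finset.sum_range_succ] at this
    linarith
  refine ⟨?_, ?_, ?_, ?_, fun n hn => ?_⟩
  · exact_mod_cast (hT 1 (by norm_num)).trans t₁
  · exact_mod_cast (hT 2 (by norm_num)).trans t₂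
  · exact_mod_cast (hT 3 (by norm_num)).trans t₃
  · exact_mod_cast (hT 4 (by norm_num)).trans t₄
  · obtain ⟨m, rfl⟩ := Nat.exists_eq_add_of_le' hn
    rw [hT _ (by omega), hT _ (by omega), hT _ (by omega), hT _ (by omega)]
    exact boardPileTotal_recurrence m
end

section
/- For n ≥ 1, define B(n) = Σ over all compositions (s₁, …, s_N) of n into positive parts of the product Π_{j=2}^{N} (s_{j−1} + s_j − 1), with the empty product equal to 1 when N = 1, and set B(0) = 0. Then the generating function of B is x(1−x)³/(1 − 5x + 7x² − 4x³); that is, as formal power series over ℤ, (1 − 5x + 7x² − 4x³) · Σ_{n≥0} B(n) xⁿ = x(1−x)³. -/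
/-- The weight of the tail of a list, and `0` if the tail is empty. -/
def boardPileTailWeight (l : List ℕ) : ℕ :=
  if l.tail = [] then 0 else boardPileWeight l.tail

theorem boardPileWeight_one_cons_cons (a : ℕ) (t : List ℕ) :
    boardPileWeight (1 :: a :: t) = a * boardPileWeight (a :: t) := by
  simp [boardPileWeight]

theorem boardPileTailWeight_one_cons_cons (a : ℕ) (t : List ℕ) :
    boardPileTailWeight (1 :: a :: t) = boardPileWeight (a :: t) := by
  simp [boardPileTailWeight]

theorem boardPileTailWeight_succ_cons (a : ℕ) (t : List ℕ) :
    boardPileTailWeight ((a + 1) :: t) = boardPileTailWeight (a :: t) :=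
  rfl

theorem boardPileWeight_succ_cons {a : ℕ} (ha : 0 < a) (t : List ℕ) :
    boardPileWeight ((a + 1) :: t) =
      boardPileWeight (a :: t) + boardPileTailWeight (a :: t) := by
  cases t with
  | nil => simp [boardPileWeight, boardPileTailWeight]
  | cons b t =>
    have h : a + 1 + b - 1 = (a + b - 1) + 1 := by omega
    simp [boardPileWeight, boardPileTailWeight, h, add_mul]

namespace Composition

theorem exists_blocks_eq_cons {n : ℕ} (c : Composition (n + 1)) :
    ∃ a t, c.blocks = a :: t ∧ 0 < a := by
  have h0 : c.blocks ≠ [] := by simp [c.blocks_eq_nil]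
  obtain ⟨a, t, h⟩ := List.exists_cons_of_ne_nil h0
  exact ⟨a, t, h, c.blocks_pos (by simp [h])⟩

/-- Prepend a block equal to `1`. -/
def consOne {n : ℕ} (c : Composition n) : Composition (n + 1) where
  blocks := 1 :: c.blocks
  blocks_pos {i} hi := by
    rcases List.mem_cons.1 hi with rfl | h
    · exact one_pos
    · exact c.blocks_pos h
  blocks_sum := by simp [add_comm]

/-- Increase the first block by `1`. -/
def succHead {n : ℕ} (c : Composition (n + 1)) : Composition (n + 2) where
  blocks := (c.blocks.headI + 1) :: c.blocks.tail
  blocks_pos {i} hi := by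
    rcases List.mem_cons.1 hi with rfl | h
    · exact Nat.succ_pos _
    · exact c.blocks_pos (List.mem_of_mem_tail h)
  blocks_sum := by
    obtain ⟨a, t, h, -⟩ := c.exists_blocks_eq_cons
    have := c.blocks_sum
    simp only [h, List.sum_cons, List.headI_cons, List.tail_cons] at this ⊢
    omega

theorem bijective_consOne_succHead (n : ℕ) :
    Function.Bijective
      (Sum.elim consOne succHead : Composition (n + 1) ⊕ Composition (n + 1) → _) := by
  constructor
  · rintro (c | c) (d | d) h <;> obtain ⟨a, t, hc, ha⟩ := c.exists_blocks_eq_cons <;>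
      obtain ⟨b, s, hd, hb⟩ := d.exists_blocks_eq_cons <;>
      simp [Composition.ext_iff, consOne, succHead, hc, hd] at h ⊢ <;> first | exact h | omega
  · intro d
    obtain ⟨a, t, hd, ha⟩ := d.exists_blocks_eq_cons
    have hs := d.blocks_sum
    rw [hd, List.sum_cons] at hs
    have ht : ∀ {i}, i ∈ t → 0 < i := fun hi => d.blocks_pos (by simp [hd, hi])
    rcases Nat.lt_or_ge 1 a with h | h
    · refine ⟨Sum.inr ⟨(a - 1) :: t, ?_, ?_⟩, ?_⟩
      · intro i hi
        rcases List.mem_cons.1 hi with rfl | hi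
        · omega
        · exact ht hi
      · rw [List.sum_cons]; omega
      · ext1
        simp only [Sum.elim_inr, succHead, hd, List.headI_cons, List.tail_cons]
        congr 1
        omega
    · refine ⟨Sum.inl ⟨t, ht, by omega⟩, ?_⟩
      ext1
      simp only [Sum.elim_inl, consOne, hd]
      congr 1
      omega

theorem sum_blocks_succ_s10 {M : Type*} [AddCommMonoid M] (n : ℕ) (f g : List ℕ → M)
    (hfg : ∀ a t, 0 < a → f (1 :: a :: t) + f ((a + 1) :: t) = g (a :: t)) :
    ∑ c : Composition (n + 2), f c.blocks = ∑ c : Composition (n + 1), g c.blocks := by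
  rw [← (bijective_consOne_succHead n).sum_comp, Fintype.sum_sum_type, ← Finset.sum_add_distrib]
  refine Finset.sum_congr rfl fun c _ => ?_
  obtain ⟨a, t, hc, ha⟩ := c.exists_blocks_eq_cons
  simpa [consOne, succHead, hc] using hfg a t ha

theorem sum_blocks_one {M : Type*} [AddCommMonoid M] (f : List ℕ → M) :
    ∑ c : Composition 1, f c.blocks = f [1] := by
  have : ∀ c : Composition 1, c = single 1 one_pos := fun c =>
    (eq_single_iff_length one_pos).2
      (le_antisymm c.length_le (c.length_pos_iff.2 one_pos))
  rw [Fintype.sum_eq_single (single 1 one_pos) fun c hc => absurd (this c) hc, single_blocks]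

end Composition

/-- The total weight of the compositions of `n + 1` satisfies a first-order linear system together
with three companion sums, weighted by the first block and by the weight of the tail. -/
theorem exists_boardPileWeight_system (P : ℕ → ℕ)
    (hP : ∀ n, P n = ∑ c : Composition (n + 1), boardPileWeight c.blocks) :
    ∃ Q R T : ℕ → ℕ, (P 0 = 1 ∧ Q 0 = 1 ∧ R 0 = 0 ∧ T 0 = 0) ∧
      ∀ n, P (n + 1) = P n + Q n + R n ∧ Q (n + 1) = P n + 2 * Q n + R n + T n ∧
        R (n + 1) = P n + R n ∧ T (n + 1) = P n + R n + T n := by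
  refine ⟨fun n => ∑ c : Composition (n + 1), c.blocks.headI * boardPileWeight c.blocks,
    fun n => ∑ c : Composition (n + 1), boardPileTailWeight c.blocks,
    fun n => ∑ c : Composition (n + 1), c.blocks.headI * boardPileTailWeight c.blocks,
    ?_, fun n => ?_⟩
  · simp only [hP, Composition.sum_blocks_one boardPileWeight,
      Composition.sum_blocks_one boardPileTailWeight,
      Composition.sum_blocks_one fun l => l.headI * boardPileWeight l,
      Composition.sum_blocks_one fun l => l.headI * boardPileTailWeight l]
    simp [boardPileWeight, boardPileTailWeight]
  · simp only [hP, Finset.mul_sum, ← Finset.sum_add_distrib]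
    refine ⟨Composition.sum_blocks_succ_s10 n boardPileWeight
        (fun l => boardPileWeight l + l.headI * boardPileWeight l + boardPileTailWeight l) ?_,
      Composition.sum_blocks_succ_s10 n (fun l => l.headI * boardPileWeight l)
        (fun l => boardPileWeight l + 2 * (l.headI * boardPileWeight l) + boardPileTailWeight l +
          l.headI * boardPileTailWeight l) ?_,
      Composition.sum_blocks_succ_s10 n boardPileTailWeight
        (fun l => boardPileWeight l + boardPileTailWeight l) ?_,
      Composition.sum_blocks_succ_s10 n (fun l => l.headI * boardPileTailWeight l)
        (fun l => boardPileWeight l + boardPileTailWeight l +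
          l.headI * boardPileTailWeight l) ?_⟩ <;>
    · intro a t ha
      simp only [boardPileWeight_one_cons_cons, boardPileTailWeight_one_cons_cons,
        List.headI_cons]
      simp only [boardPileTailWeight_succ_cons, boardPileWeight_succ_cons ha] <;>
      ring

/-- Let `B n` (for `n ≥ 1`) be the sum, over all compositions `(s₁, …, s_N)`
of `n` into positive parts, of the product `∏_{j=2}^{N} (s_{j-1} + s_j - 1)`
(the empty product being `1` when `N = 1`), i.e. the number of board-pile
`n`-ominoes, and set `B 0 = 0`.  Then, as formal power series over `ℤ`,
`(1 - 5x + 7x² - 4x³) · ∑_{n≥0} B(n) xⁿ = x(1-x)³`. -/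
theorem boardPile_generating_function (B : ℕ → ℕ) (hB0 : B 0 = 0)
    (hB : ∀ n : ℕ, 1 ≤ n →
      B n = ∑ cmp : Composition n,
        ((cmp.blocks.zip cmp.blocks.tail).map (fun p => p.1 + p.2 - 1)).prod) :
    (1 - 5 * PowerSeries.X + 7 * PowerSeries.X ^ 2 - 4 * PowerSeries.X ^ 3) *
        PowerSeries.mk (fun n => (B n : ℤ)) =
      PowerSeries.X * (1 - PowerSeries.X) ^ 3 := by
  obtain ⟨Q, R, T, ⟨hP0, hQ0, hR0, hT0⟩, h⟩ :=
    exists_boardPileWeight_system (fun n => B (n + 1)) fun n => hB (n + 1) (Nat.le_add_left 1 n)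
  have hrec : ∀ n, (B (n + 5) : ℤ) = 5 * B (n + 4) - 7 * B (n + 3) + 4 * B (n + 2) := by
    intro n
    have h0 := h n
    have h1 := h (n + 1)
    have h2 := h (n + 2)
    have h3 := h (n + 3)
    simp only [add_assoc, Nat.reduceAdd] at h0 h1 h2 h3
    omega
  have h0 := h 0
  have h1 := h 1
  have h2 := h 2
  simp only [Nat.reduceAdd] at hP0 h0 h1 h2
  have e2 : B 2 = 2 := by omega
  have e3 : B 3 = 6 := by omega
  have e4 : B 4 = 19 := by omega
  have c3 : (3 : PowerSeries ℤ) = PowerSeries.C 3 := (map_ofNat PowerSeries.C 3).symm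
  have c4 : (4 : PowerSeries ℤ) = PowerSeries.C 4 := (map_ofNat PowerSeries.C 4).symm
  have c5 : (5 : PowerSeries ℤ) = PowerSeries.C 5 := (map_ofNat PowerSeries.C 5).symm
  have c7 : (7 : PowerSeries ℤ) = PowerSeries.C 7 := (map_ofNat PowerSeries.C 7).symm
  have hX : (PowerSeries.X * (1 - PowerSeries.X) ^ 3 : PowerSeries ℤ) =
      PowerSeries.X ^ 1 - 3 * PowerSeries.X ^ 2 + 3 * PowerSeries.X ^ 3 - PowerSeries.X ^ 4 := by
    ring
  rw [hX, c3, c4, c5, c7]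
  ext n
  simp only [sub_mul, add_mul, one_mul, mul_assoc, map_sub, map_add, PowerSeries.coeff_C_mul,
    PowerSeries.coeff_X_pow_mul', PowerSeries.coeff_X_pow, PowerSeries.coeff_mk]
  rcases n with _ | _ | _ | _ | _ | n
  · simp [hB0]
  · simp [hB0, hP0]
  · simp [hB0, hP0, e2]
  · simp [hB0, hP0, e2, e3]
  · simp [hP0, e2, e3, e4]
  · simp [hrec]
    ring
end

section
/- For every finite simple graph G and every configuration c : V → ℤ, the parallel diffusion process is eventually periodic with period length 1 or 2: there exists N ≥ 0 such that F_G^{t+2}(c) = F_G^t(c) for all t ≥ N. -/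
/-- The parallel diffusion firing operator on a finite simple graph `G`:
each vertex gains a chip from each richer neighbour and sends a chip to each
poorer neighbour. -/
def fire {V : Type*} [Fintype V] [DecidableEq V] (G : SimpleGraph V)
    [DecidableRel G.Adj] (c : V → ℤ) : V → ℤ :=
  fun v =>
    c v + ((Finset.univ.filter fun u => G.Adj v u ∧ c v < c u).card : ℤ)
        - ((Finset.univ.filter fun u => G.Adj v u ∧ c u < c v).card : ℤ)

open Filter in
/-- An antitone integer sequence that is bounded below is eventually constant. -/
theorem Antitone.eventually_succ_eq_of_le {f : ℕ → ℤ} (hf : Antitone f) {b : ℤ}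
    (hb : ∀ t, b ≤ f t) : ∀ᶠ t in atTop, f (t + 1) = f t := by
  obtain ⟨m, ⟨N, rfl⟩, hm⟩ := Int.exists_least_of_bdd (P := fun z => ∃ t, f t = z)
    ⟨b, by rintro z ⟨t, rfl⟩; exact hb t⟩ ⟨f 0, 0, rfl⟩
  filter_upwards [eventually_ge_atTop N] with t ht
  exact le_antisymm (hf t.le_succ) ((hf ht).trans (hm _ ⟨t + 1, rfl⟩))

section Diffusion

open Finset Filter

variable {V : Type*} (G : SimpleGraph V) [DecidableRel G.Adj]

/-- The net number of chips that `v` receives from `u` when `c` fires. -/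
def flow (c : V → ℤ) (v u : V) : ℤ :=
  if G.Adj v u then (c u - c v).sign else 0

theorem flow_swap (c : V → ℤ) (v u : V) : flow G c u v = -flow G c v u := by
  simp only [flow, G.adj_comm u v]
  rw [← neg_sub (c u) (c v), Int.sign_neg]
  split_ifs <;> simp

theorem abs_flow_le_one (c : V → ℤ) (v u : V) : |flow G c v u| ≤ 1 := by
  unfold flow
  split_ifs
  · rcases Int.sign_trichotomy (c u - c v) with h | h | h <;> simp [h]
  · simp

theorem flow_add_flow_mul_sub_nonneg (c d : V → ℤ) (v u : V) :
    0 ≤ (flow G c v u + flow G d v u) * (d u - d v) := by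
  have h := abs_le.1 (abs_flow_le_one G c v u)
  by_cases ha : G.Adj v u
  · have hd : flow G d v u = (d u - d v).sign := if_pos ha
    rcases lt_trichotomy (d u - d v) 0 with hs | hs | hs
    · rw [hd, Int.sign_eq_neg_one_of_neg hs]
      nlinarith
    · simp [hs]
    · rw [hd, Int.sign_eq_one_of_pos hs]
      nlinarith
  · simp [flow, ha]

theorem flow_eq_zero_or_eq_neg {c d : V → ℤ} {v u : V}
    (h : (flow G c v u + flow G d v u) * (d u - d v) = 0) :
    flow G d v u = 0 ∨ flow G d v u = -flow G c v u := by
  rcases mul_eq_zero.1 h with h | h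
  · right; linarith
  · left; simp [flow, h]

variable [Fintype V]

theorem two_mul_sum_mul_sum_of_antisymm {a : V → V → ℤ} (ha : ∀ v u, a u v = -a v u)
    (d : V → ℤ) :
    2 * ∑ v, d v * ∑ u, a v u = -∑ v, ∑ u, a v u * (d u - d v) := by
  have h : ∑ v, ∑ u, a v u * d u = -∑ v, ∑ u, a v u * d v := by
    rw [sum_comm]
    simp_rw [← sum_neg_distrib]
    refine sum_congr rfl fun v _ => sum_congr rfl fun u _ => ?_
    rw [ha v u]
    ring
  have h' : ∑ v, d v * ∑ u, a v u = ∑ v, ∑ u, a v u * d v := by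
    simp_rw [mul_sum, mul_comm]
  simp_rw [mul_sub, sum_sub_distrib]
  rw [h, h']
  ring

variable [DecidableEq V]

theorem fire_apply_eq_add_sum_flow (c : V → ℤ) (v : V) :
    fire G c v = c v + ∑ u, flow G c v u := by
  rw [fire, card_filter, card_filter, add_sub_assoc]
  push_cast
  rw [← sum_sub_distrib]
  congr 1
  refine sum_congr rfl fun u _ => ?_
  unfold flow
  rcases lt_trichotomy (c v) (c u) with h | h | h
  · simp [h, h.not_gt, Int.sign_eq_one_of_pos (sub_pos.2 h)]
  · simp [h]
  · simp [h, h.not_gt, Int.sign_eq_neg_one_of_neg (sub_neg.2 h), neg_ite]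

/-- The correlation of consecutive configurations drops by half the total of the nonnegative
quantities in `flow_add_flow_mul_sub_nonneg`. -/
theorem two_mul_sum_mul_sub_fire_fire (c : V → ℤ) :
    2 * (∑ v, c v * fire G c v - ∑ v, fire G c v * fire G (fire G c) v) =
      ∑ v, ∑ u, (flow G c v u + flow G (fire G c) v u) * (fire G c u - fire G c v) := by
  have h := two_mul_sum_mul_sum_of_antisymm
    (a := fun v u => flow G c v u + flow G (fire G c) v u)
    (fun v u => by rw [flow_swap G c v u, flow_swap G (fire G c) v u]; ring) (fire G c)
  rw [eq_neg_iff_add_eq_zero] at h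
  rw [← sub_eq_zero, ← neg_eq_zero, ← h, ← sum_sub_distrib]
  have h' : ∀ v, fire G c v * ∑ u, (flow G c v u + flow G (fire G c) v u) =
      -(c v * fire G c v - fire G c v * fire G (fire G c) v) := fun v => by
    rw [sum_add_distrib, fire_apply_eq_add_sum_flow G (fire G c) v,
      eq_sub_of_add_eq' (fire_apply_eq_add_sum_flow G c v).symm]
    ring
  simp_rw [h', sum_neg_distrib]
  ring

theorem neg_le_sum_mul_fire (c : V → ℤ) :
    -(∑ _v : V, (Fintype.card V : ℤ) ^ 2) ≤ ∑ v, c v * fire G c v := by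
  rw [← sum_neg_distrib]
  refine sum_le_sum fun v _ => ?_
  have h : |∑ u, flow G c v u| ≤ Fintype.card V :=
    (abs_sum_le_sum_abs _ _).trans <|
      (sum_le_sum fun u _ => abs_flow_le_one G c v u).trans (by simp)
  have h' := sq_le_sq' (abs_le.1 h).1 (abs_le.1 h).2
  rw [fire_apply_eq_add_sum_flow]
  nlinarith [sq_nonneg (2 * c v + ∑ u, flow G c v u)]

theorem eventually_flow_iterate_succ (c : V → ℤ) :
    ∀ᶠ t in atTop, ∀ v u,
      flow G ((fire G)^[t + 1] c) v u = -flow G ((fire G)^[t] c) v u := by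
  let E : ℕ → ℤ := fun t => ∑ v, (fire G)^[t] c v * (fire G)^[t + 1] c v
  have hE : ∀ t, 2 * (E t - E (t + 1)) = ∑ v, ∑ u,
      (flow G ((fire G)^[t] c) v u + flow G ((fire G)^[t + 1] c) v u) *
        ((fire G)^[t + 1] c u - (fire G)^[t + 1] c v) := fun t => by
    simp only [E, Function.iterate_succ_apply']
    exact two_mul_sum_mul_sub_fire_fire G _
  have hterm := fun t v u => flow_add_flow_mul_sub_nonneg G ((fire G)^[t] c)
    ((fire G)^[t + 1] c) v u
  have hanti : Antitone E := antitone_nat_of_succ_le fun t => by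
    have := sum_nonneg fun v (_ : v ∈ univ) => sum_nonneg fun u (_ : u ∈ univ) => hterm t v u
    rw [← hE] at this
    linarith
  obtain ⟨N, hN⟩ := eventually_atTop.1 <| hanti.eventually_succ_eq_of_le fun t => by
    simp only [E, Function.iterate_succ_apply']
    exact neg_le_sum_mul_fire G _
  have hstep : ∀ t, N ≤ t → ∀ v u, flow G ((fire G)^[t + 1] c) v u = 0 ∨
      flow G ((fire G)^[t + 1] c) v u = -flow G ((fire G)^[t] c) v u := by
    intro t ht v u
    have h := hE t
    rw [hN t ht, sub_self, mul_zero, eq_comm,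
      sum_eq_zero_iff_of_nonneg fun v _ => sum_nonneg fun u _ => hterm t v u] at h
    have h' := (sum_eq_zero_iff_of_nonneg fun u _ => hterm t v u).1 (h v (mem_univ v))
    exact flow_eq_zero_or_eq_neg G (h' u (mem_univ u))
  simp_rw [eventually_all]
  intro v u
  by_cases hz : ∃ M, N ≤ M ∧ flow G ((fire G)^[M] c) v u = 0
  · obtain ⟨M, hM, hM0⟩ := hz
    have hzero : ∀ t, M ≤ t → flow G ((fire G)^[t] c) v u = 0 := fun t ht => by
      induction t, ht using Nat.le_induction with
      | base => exact hM0
      | succ t ht ih => simpa [ih] using hstep t (hM.trans ht) v u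
    filter_upwards [eventually_ge_atTop M] with t ht
    rw [hzero t ht, hzero (t + 1) (ht.trans t.le_succ), neg_zero]
  · push Not at hz
    filter_upwards [eventually_ge_atTop N] with t ht
    exact (hstep t ht v u).resolve_left (hz (t + 1) (ht.trans t.le_succ))

end Diffusion

/-- Parallel diffusion is eventually periodic with period length 1 or 2:
there is some `N` such that for all `t ≥ N`, firing twice more from step `t`
returns the configuration at step `t`. -/
theorem diffusion_eventually_period_two {V : Type*} [Fintype V] [DecidableEq V]
    (G : SimpleGraph V) [DecidableRel G.Adj] (c : V → ℤ) :
    ∃ N : ℕ, ∀ t : ℕ, N ≤ t → (fire G)^[t + 2] c = (fire G)^[t] c := by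
  obtain ⟨N, hN⟩ := Filter.eventually_atTop.1 (eventually_flow_iterate_succ G c)
  refine ⟨N, fun t ht => funext fun v => ?_⟩
  rw [Function.iterate_succ_apply', fire_apply_eq_add_sum_flow,
    Finset.sum_congr rfl fun u _ => hN t ht v u, Function.iterate_succ_apply',
    fire_apply_eq_add_sum_flow, Finset.sum_neg_distrib, add_neg_cancel_right]
end

section
/- For every finite simple graph G and every configuration c : V → ℤ, if F_G^p(c) = c for some integer p ≥ 1, then F_G(F_G(c)) = c. That is, every period configuration has period length 1 or 2. -/
namespace ParallelDiffusion

variable {V : Type*} (G : SimpleGraph V) [DecidableRel G.Adj]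

/-- The signed flow of chips from `u` to `v` in one firing step. -/
def flow (c : V → ℤ) (v u : V) : ℤ := if G.Adj v u then (c u - c v).sign else 0

lemma flow_swap (c : V → ℤ) (v u : V) : flow G c v u = -flow G c u v := by
  simp only [flow, G.adj_comm v u]
  split_ifs
  · rw [← Int.sign_neg, neg_sub]
  · simp

lemma flow_mul_sub_le (c x : V → ℤ) (v u : V) :
    -(flow G c v u * (x u - x v)) ≤ flow G x v u * (x u - x v) := by
  unfold flow
  split_ifs
  · rw [Int.sign_mul_self_eq_abs]
    rcases Int.sign_trichotomy (c u - c v) with h | h | h <;> rw [h] <;>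
      grind
  · simp

variable [Fintype V]

lemma fire_eq_add_sum_flow [DecidableEq V] (c : V → ℤ) (v : V) :
    fire G c v = c v + ∑ u, flow G c v u := by
  have key : ∀ u, flow G c v u =
      (if G.Adj v u ∧ c v < c u then 1 else 0) - (if G.Adj v u ∧ c u < c v then 1 else 0) := by
    intro u
    unfold flow
    by_cases hadj : G.Adj v u
    · rcases lt_trichotomy (c v) (c u) with h | h | h
      · simp [hadj, h, h.not_gt, Int.sign_eq_one_of_pos (sub_pos.2 h)]
      · simp [h]
      · simp [hadj, h, h.not_gt, Int.sign_eq_neg_one_of_neg (sub_neg.2 h)]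
    · simp [hadj]
  simp only [key, Finset.sum_sub_distrib, Finset.sum_boole, fire]
  ring

lemma two_mul_sum_flow_mul (c w : V → ℤ) :
    2 * ∑ v, (∑ u, flow G c v u) * w v = -∑ v, ∑ u, flow G c v u * (w u - w v) := by
  have h : ∑ v, ∑ u, flow G c v u * w u = -∑ v, ∑ u, flow G c v u * w v := by
    rw [Finset.sum_comm]
    simp only [← Finset.sum_neg_distrib]
    refine Finset.sum_congr rfl fun v _ => Finset.sum_congr rfl fun u _ => ?_
    rw [flow_swap G c u v, neg_mul]
  simp only [mul_sub, Finset.sum_sub_distrib, h, Finset.sum_mul]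
  ring

/-- A quantity which does not increase under firing. -/
def energy (c : V → ℤ) : ℤ := 2 * ∑ v, c v ^ 2 - ∑ v, ∑ u, flow G c v u * (c u - c v)

lemma energy_fire [DecidableEq V] (c : V → ℤ) :
    energy G (fire G c) = energy G c - ∑ v, ∑ u,
      (flow G (fire G c) v u * (fire G c u - fire G c v) +
        flow G c v u * (fire G c u - fire G c v)) := by
  have h := two_mul_sum_flow_mul G c (fun v => c v + fire G c v)
  have hsq : ∑ v, (∑ u, flow G c v u) * (c v + fire G c v) =
      ∑ v, fire G c v ^ 2 - ∑ v, c v ^ 2 := by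
    rw [← Finset.sum_sub_distrib]
    refine Finset.sum_congr rfl fun v _ => ?_
    rw [fire_eq_add_sum_flow]
    ring
  have hsplit : ∑ v, ∑ u, flow G c v u * (c u + fire G c u - (c v + fire G c v)) =
      ∑ v, ∑ u, flow G c v u * (c u - c v) +
        ∑ v, ∑ u, flow G c v u * (fire G c u - fire G c v) := by
    simp only [← Finset.sum_add_distrib]
    refine Finset.sum_congr rfl fun v _ => Finset.sum_congr rfl fun u _ => ?_
    ring
  simp only [energy, Finset.sum_add_distrib]
  linarith

lemma energy_fire_le [DecidableEq V] (c : V → ℤ) : energy G (fire G c) ≤ energy G c := by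
  rw [energy_fire, sub_le_self_iff]
  refine Finset.sum_nonneg fun v _ => Finset.sum_nonneg fun u _ => ?_
  linarith [flow_mul_sub_le G c (fire G c) v u]

/-- Where no energy is lost, every nonzero flow is the reversal of the preceding one. -/
lemma flow_fire_of_energy_eq [DecidableEq V] {c : V → ℤ}
    (h : energy G (fire G c) = energy G c) (v u : V) (hne : flow G (fire G c) v u ≠ 0) :
    flow G (fire G c) v u = -flow G c v u := by
  rw [energy_fire, sub_eq_self] at h
  have hnonneg : ∀ v u, 0 ≤ flow G (fire G c) v u * (fire G c u - fire G c v) +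
      flow G c v u * (fire G c u - fire G c v) := fun v u => by
    linarith [flow_mul_sub_le G c (fire G c) v u]
  rw [Finset.sum_eq_zero_iff_of_nonneg fun v _ => Finset.sum_nonneg fun u _ => hnonneg v u] at h
  have hv := h v (Finset.mem_univ v)
  rw [Finset.sum_eq_zero_iff_of_nonneg fun u _ => hnonneg v u] at hv
  have hu := hv u (Finset.mem_univ u)
  rw [← add_mul, mul_eq_zero] at hu
  rcases hu with hu | hu
  · linarith
  · exact absurd (by simp [flow, hu]) hne

lemma energy_iterate_antitone [DecidableEq V] (c : V → ℤ) :
    Antitone fun n => energy G ((fire G)^[n] c) :=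
  antitone_nat_of_succ_le fun n => by
    rw [Function.iterate_succ_apply']
    exact energy_fire_le G _

lemma energy_fire_eq_of_isPeriodicPt [DecidableEq V] {c : V → ℤ} {p : ℕ} (hp : 1 ≤ p)
    (h : Function.IsPeriodicPt (fire G) p c) : energy G (fire G c) = energy G c := by
  refine le_antisymm (energy_fire_le G c) ?_
  simpa [h.eq] using energy_iterate_antitone G c hp

lemma flow_fire_of_isPeriodicPt [DecidableEq V] {c : V → ℤ} {p : ℕ} (hp : 1 ≤ p)
    (h : Function.IsPeriodicPt (fire G) p c) (v u : V) :
    flow G (fire G c) v u = -flow G c v u := by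
  have step : ∀ n, flow G ((fire G)^[n + 1] c) v u ≠ 0 →
      flow G ((fire G)^[n + 1] c) v u = -flow G ((fire G)^[n] c) v u := by
    intro n
    rw [Function.iterate_succ_apply']
    exact flow_fire_of_energy_eq G
      (energy_fire_eq_of_isPeriodicPt G hp (h.apply_iterate n)) v u
  have vanish : flow G ((fire G)^[1] c) v u = 0 → flow G ((fire G)^[p] c) v u = 0 := by
    intro h₁
    refine Nat.le_induction (P := fun n _ => flow G ((fire G)^[n] c) v u = 0) h₁
      (fun n _ ih => ?_) p hp
    by_contra hne
    exact hne (by rw [step n hne, ih, neg_zero])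
  by_cases h₁ : flow G (fire G c) v u = 0
  · have h₀ := vanish h₁
    rw [h.eq] at h₀
    rw [h₁, h₀, neg_zero]
  · exact step 0 h₁

end ParallelDiffusion

/-- Every period configuration of parallel diffusion has period length 1 or 2:
if `F_G^p(c) = c` for some `p ≥ 1`, then `F_G(F_G(c)) = c`. -/
theorem period_config_period_two {V : Type*} [Fintype V] [DecidableEq V]
    (G : SimpleGraph V) [DecidableRel G.Adj] (c : V → ℤ)
    (p : ℕ) (hp : 1 ≤ p) (h : (fire G)^[p] c = c) :
    fire G (fire G c) = c := by
  funext v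
  rw [ParallelDiffusion.fire_eq_add_sum_flow, ParallelDiffusion.fire_eq_add_sum_flow]
  simp [ParallelDiffusion.flow_fire_of_isPeriodicPt G hp h]
end
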